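/- For any complex n×n matrix X with ‖X‖ = 1 and any complex matrix Y with ‖Y‖ = 1, the quadratic form ⟨T_X Y, Y⟩ = ‖[X,Y]‖² is at most 2; in particular the largest eigenvalue of T_X(Y) = [X*,[X,Y]] satisfies λ₁(T_X) ≤ 2. -/

import Mathlib

open Matrix

/-- The operator `T_X (Y) = [X*, [X, Y]]`. -/
noncomputable def TX {n : ℕ} (X Y : Matrix (Fin n) (Fin n) ℂ) : Matrix (Fin n) (Fin n) ℂ :=
  Xᴴ * (X * Y - Y * X) - (X * Y - Y * X) * Xᴴ

section BW

open scoped ComplexOrder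

theorem bw_scalar {n : ℕ} (hn : 0 < n) (d : Fin n → ℝ) :
    ∃ a : ℝ, ∀ i, (d i - a) ^ 2 ≤ (∑ j, d j ^ 2) / 2 := by
  have : Nonempty (Fin n) := ⟨⟨0, hn⟩⟩
  obtain ⟨p, hp⟩ := Finite.exists_max d
  obtain ⟨q, hq⟩ := Finite.exists_min d
  refine ⟨(d p + d q) / 2, fun i => ?_⟩
  have h1 := hp i
  have h2 := hq i
  by_cases hpq : p = q
  · subst hpq
    have : d i = d p := le_antisymm h1 h2
    rw [this]
    have : 0 ≤ ∑ j, d j ^ 2 := Finset.sum_nonneg fun j _ => sq_nonneg _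
    have e : d p - (d p + d p) / 2 = 0 := by ring
    rw [e]; linarith [this]
  · have hs : d p ^ 2 + d q ^ 2 ≤ ∑ j, d j ^ 2 := by
      rw [← Finset.sum_pair (f := fun j => d j ^ 2) hpq]
      exact Finset.sum_le_sum_of_subset_of_nonneg (Finset.subset_univ _)
        fun j _ _ => sq_nonneg _
    nlinarith [mul_nonneg (sub_nonneg.2 h1) (sub_nonneg.2 h2), sq_nonneg (d p + d q)]

theorem bw_herm {n : ℕ} (hn : 0 < n) (A : Matrix (Fin n) (Fin n) ℂ) (hA : A.IsHermitian) :
    ∃ a : ℝ, PosSemidef ((((trace (A * A)).re / 2 : ℝ) : ℂ) • (1 : Matrix (Fin n) (Fin n) ℂ)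
      - (A - (a : ℂ) • 1) * (A - (a : ℂ) • 1)) := by
  obtain ⟨a, ha⟩ := bw_scalar hn hA.eigenvalues
  obtain ⟨U, d, hUU, hUU', hAU, rfl⟩ : ∃ (U : Matrix (Fin n) (Fin n) ℂ) (d : Fin n → ℝ),
      Uᴴ * U = 1 ∧ U * Uᴴ = 1 ∧ A = U * diagonal (fun i => (d i : ℂ)) * Uᴴ
        ∧ d = hA.eigenvalues := by
    refine ⟨hA.eigenvectorUnitary, hA.eigenvalues, ?_, ?_, ?_, rfl⟩
    · exact Unitary.coe_star_mul_self hA.eigenvectorUnitary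
    · exact Unitary.coe_mul_star_self hA.eigenvectorUnitary
    · exact hA.spectral_theorem
  generalize hA.eigenvalues = d at *
  have key : ∀ M N : Matrix (Fin n) (Fin n) ℂ, (U * M * Uᴴ) * (U * N * Uᴴ) = U * (M * N) * Uᴴ := by
    intro M N
    calc _ = U * M * (Uᴴ * U) * N * Uᴴ := by noncomm_ring
      _ = _ := by rw [hUU]; noncomm_ring
  have htr : (trace (A * A)).re = ∑ j, d j ^ 2 := by
    rw [hAU, key, trace_mul_comm, ← Matrix.mul_assoc, hUU, Matrix.one_mul, diagonal_mul_diagonal,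
      trace_diagonal]
    rw [Complex.re_sum]
    refine Finset.sum_congr rfl fun j _ => ?_
    rw [← Complex.ofReal_mul, Complex.ofReal_re, sq]
  refine ⟨a, ?_⟩
  rw [htr]
  have h1 : (1 : Matrix (Fin n) (Fin n) ℂ) = U * 1 * Uᴴ := by rw [Matrix.mul_one, hUU']
  have hsub : A - (a : ℂ) • 1 = U * diagonal (fun i => ((d i - a : ℝ) : ℂ)) * Uᴴ := by
    have : diagonal (fun i => ((d i - a : ℝ) : ℂ))
        = diagonal (fun i => (d i : ℂ)) - (a : ℂ) • 1 := by
      rw [smul_one_eq_diagonal, diagonal_sub]; simp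
    rw [this, Matrix.mul_sub, Matrix.sub_mul, ← hAU, Matrix.mul_smul, Matrix.smul_mul, ← h1]
  have hfin : ((((∑ j, d j ^ 2) / 2 : ℝ) : ℂ) • (1 : Matrix (Fin n) (Fin n) ℂ)
      - (A - (a : ℂ) • 1) * (A - (a : ℂ) • 1))
      = U * diagonal (fun i => (((∑ j, d j ^ 2) / 2 - (d i - a) ^ 2 : ℝ) : ℂ)) * Uᴴ := by
    have : diagonal (fun i => (((∑ j, d j ^ 2) / 2 - (d i - a) ^ 2 : ℝ) : ℂ))
        = (((∑ j, d j ^ 2) / 2 : ℝ) : ℂ) • (1 : Matrix (Fin n) (Fin n) ℂ)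
          - diagonal (fun i => ((d i - a : ℝ) : ℂ)) * diagonal (fun i => ((d i - a : ℝ) : ℂ)) := by
      rw [smul_one_eq_diagonal, diagonal_mul_diagonal, diagonal_sub]
      congr 1; funext i; push_cast; ring
    rw [hsub, key, this, Matrix.mul_sub U, Matrix.sub_mul, Matrix.mul_smul, Matrix.smul_mul, ← h1]
  rw [hfin]
  apply PosSemidef.mul_mul_conjTranspose_same
  rw [posSemidef_diagonal_iff]
  intro i
  have := ha i
  exact_mod_cast (by linarith : (0 : ℝ) ≤ (∑ j, d j ^ 2) / 2 - (d i - a) ^ 2)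

theorem bw_trace {n : ℕ} (X P : Matrix (Fin n) (Fin n) ℂ) (hP : PosSemidef P) :
    0 ≤ (trace ((Xᴴ * X + X * Xᴴ) * P)).re := by
  have h1 := (hP.mul_mul_conjTranspose_same X).trace_nonneg
  have h2 := (hP.mul_mul_conjTranspose_same Xᴴ).trace_nonneg
  have e : trace ((Xᴴ * X + X * Xᴴ) * P) = trace (X * P * Xᴴ) + trace (Xᴴ * P * Xᴴᴴ) := by
    rw [Matrix.add_mul, trace_add, conjTranspose_conjTranspose, Matrix.mul_assoc Xᴴ X P,
      trace_mul_comm Xᴴ, trace_mul_cycle Xᴴ P X]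
  rw [e, Complex.add_re]
  exact add_nonneg (Complex.le_def.1 h1).1 (Complex.le_def.1 h2).1

theorem bw_var {n : ℕ} (hn : 0 < n) (X A : Matrix (Fin n) (Fin n) ℂ) (hA : A.IsHermitian)
    (hX : (trace (X * Xᴴ)).re = 1) :
    ∃ a : ℝ, (trace ((Xᴴ * X + X * Xᴴ) * ((A - (a : ℂ) • 1) * (A - (a : ℂ) • 1)))).re
      ≤ (trace (A * A)).re := by
  obtain ⟨a, ha⟩ := bw_herm hn A hA
  refine ⟨a, ?_⟩
  have h := bw_trace X _ ha
  rw [Matrix.mul_sub, trace_sub, Complex.sub_re, Matrix.mul_smul, Matrix.mul_one, trace_smul,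
    smul_eq_mul, Complex.re_ofReal_mul, trace_add, trace_mul_comm Xᴴ, Complex.add_re, hX] at h
  linarith

theorem bw_nonneg {n : ℕ} (Z : Matrix (Fin n) (Fin n) ℂ) : 0 ≤ (trace (Z * Zᴴ)).re :=
  (Complex.le_def.1 (posSemidef_self_mul_conjTranspose Z).trace_nonneg).1

theorem bw_conj {n : ℕ} (Z : Matrix (Fin n) (Fin n) ℂ) : (trace Zᴴ).re = (trace Z).re := by
  rw [trace_conjTranspose]; simp

/-- The identity bounding the commutator by an anticommutator expression. -/
theorem bw_comm {n : ℕ} (X Y : Matrix (Fin n) (Fin n) ℂ) :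
    (trace ((X * Y - Y * X) * (X * Y - Y * X)ᴴ)).re
      ≤ (trace ((Xᴴ * X + X * Xᴴ) * (Y * Yᴴ + Yᴴ * Y))).re := by
  have h := bw_nonneg (Xᴴ * Y + Y * Xᴴ)
  have c1 := bw_conj (X * Y * Xᴴ * Yᴴ)
  have c2 := bw_conj (Y * X * Yᴴ * Xᴴ)
  simp only [conjTranspose_add, conjTranspose_sub, conjTranspose_mul, conjTranspose_conjTranspose,
    Matrix.mul_add, Matrix.add_mul, Matrix.mul_sub, Matrix.sub_mul, trace_add, trace_sub,
    Complex.add_re, Complex.sub_re, ← Matrix.mul_assoc] at *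
  have t1 : trace (X * Y * Yᴴ * Xᴴ) = trace (Xᴴ * X * Y * Yᴴ) := by
    rw [trace_mul_comm]; simp only [← Matrix.mul_assoc]
  have t2 : trace (Y * X * Xᴴ * Yᴴ) = trace (X * Xᴴ * Yᴴ * Y) := by
    rw [Matrix.mul_assoc, Matrix.mul_assoc, trace_mul_comm]; simp only [← Matrix.mul_assoc]
  have t3 : trace (Xᴴ * Y * Yᴴ * X) = trace (X * Xᴴ * Y * Yᴴ) := by
    rw [trace_mul_comm]; simp only [← Matrix.mul_assoc]
  have t4 : trace (Y * Xᴴ * X * Yᴴ) = trace (Xᴴ * X * Yᴴ * Y) := by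
    rw [Matrix.mul_assoc, Matrix.mul_assoc, trace_mul_comm]; simp only [← Matrix.mul_assoc]
  have t5 : trace (Xᴴ * Y * X * Yᴴ) = trace (Y * X * Yᴴ * Xᴴ) := by
    rw [Matrix.mul_assoc, Matrix.mul_assoc, trace_mul_comm]; simp only [← Matrix.mul_assoc]
  have t6 : trace (Y * Xᴴ * Yᴴ * X) = trace (X * Y * Xᴴ * Yᴴ) := by
    rw [trace_mul_comm]; simp only [← Matrix.mul_assoc]
  rw [t1, t2]
  rw [t3, t4, t5, t6] at h
  linarith

theorem bw_main {n : ℕ} (hn : 0 < n) (X Y : Matrix (Fin n) (Fin n) ℂ)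
    (hX : (trace (X * Xᴴ)).re = 1) :
    (trace ((X * Y - Y * X) * (X * Y - Y * X)ᴴ)).re ≤ 2 * (trace (Y * Yᴴ)).re := by
  obtain ⟨A, B, hA, hB, rfl⟩ : ∃ A B : Matrix (Fin n) (Fin n) ℂ, Aᴴ = A ∧ Bᴴ = B ∧
      Y = A + Complex.I • B := by
    refine ⟨(1 / 2 : ℂ) • (Y + Yᴴ), (-Complex.I / 2) • (Y - Yᴴ), ?_, ?_, ?_⟩
    · ext i j; simp; ring
    · ext i j; simp; ring
    · ext i j; simp; ring_nf; simp; ring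
  obtain ⟨a, ha⟩ := bw_var hn X A hA hX
  obtain ⟨b, hb⟩ := bw_var hn X B hB hX
  have hq : ∀ M N : Matrix (Fin n) (Fin n) ℂ, Mᴴ = M → Nᴴ = N →
      (M + Complex.I • N) * (M + Complex.I • N)ᴴ + (M + Complex.I • N)ᴴ * (M + Complex.I • N)
        = (2 : ℂ) • (M * M + N * N) := by
    intro M N hM hN
    simp only [conjTranspose_add, conjTranspose_smul, hM, hN, Matrix.mul_add, Matrix.add_mul,
      Matrix.smul_mul, Matrix.mul_smul, smul_smul, smul_add]
    simp
    module
  have hnorm : (trace ((A + Complex.I • B) * (A + Complex.I • B)ᴴ)).re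
      = (trace (A * A)).re + (trace (B * B)).re := by
    have h := congrArg (fun Z => (trace Z).re) (hq A B hA hB)
    simp only [trace_add, trace_smul, Complex.add_re, smul_eq_mul] at h
    rw [trace_mul_comm (A + Complex.I • B)ᴴ] at h
    simp at h
    simp
    linarith
  have hsa : (A - (a : ℂ) • 1)ᴴ = A - (a : ℂ) • 1 := by simp [hA]
  have hsb : (B - (b : ℂ) • 1)ᴴ = B - (b : ℂ) • 1 := by simp [hB]
  have hc := bw_comm X ((A - (a : ℂ) • 1) + Complex.I • (B - (b : ℂ) • 1))
  rw [hq _ _ hsa hsb] at hc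
  have he : X * ((A - (a : ℂ) • 1) + Complex.I • (B - (b : ℂ) • 1))
      - ((A - (a : ℂ) • 1) + Complex.I • (B - (b : ℂ) • 1)) * X
      = X * (A + Complex.I • B) - (A + Complex.I • B) * X := by
    simp only [Matrix.mul_add, Matrix.add_mul, Matrix.mul_sub, Matrix.sub_mul, Matrix.mul_smul,
      Matrix.smul_mul, Matrix.mul_one, Matrix.one_mul]
    module
  rw [he, Matrix.mul_smul, Matrix.mul_add (Xᴴ * X + X * Xᴴ), trace_smul, trace_add, smul_eq_mul] at hc
  rw [hnorm]
  have e2 : ∀ z w : ℂ, (2 * (z + w)).re = 2 * (z.re + w.re) := by intro z w; simp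
  rw [e2] at hc
  linarith

end BW

/-- For a unit-norm `X`, the quadratic form `⟨T_X Y, Y⟩ = ‖[X,Y]‖²` is at most `2` on unit
vectors; in particular the largest eigenvalue of `T_X` is at most `2`, where the eigenvalues
`μ` (in decreasing order) are given via an orthonormal eigenbasis `V` of `M(n,ℂ)`. -/
theorem TX_top_eigenvalue_le_two (n : ℕ) (hn : 0 < n)
    (X : Matrix (Fin n) (Fin n) ℂ) (hX : (trace (X * Xᴴ)).re = 1)
    (μ : Fin (n * n) → ℝ) (hmono : Antitone μ)
    (V : Fin (n * n) → Matrix (Fin n) (Fin n) ℂ)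
    (horth : ∀ i j, trace (V i * (V j)ᴴ) = if i = j then 1 else 0)
    (heig : ∀ i, TX X (V i) = (μ i : ℂ) • V i) :
    (∀ Y : Matrix (Fin n) (Fin n) ℂ, (trace (Y * Yᴴ)).re = 1 →
        (trace ((X * Y - Y * X) * (X * Y - Y * X)ᴴ)).re ≤ 2) ∧
    μ ⟨0, Nat.mul_pos hn hn⟩ ≤ 2 := by
  have main : ∀ Y : Matrix (Fin n) (Fin n) ℂ, (trace (Y * Yᴴ)).re = 1 →
        (trace ((X * Y - Y * X) * (X * Y - Y * X)ᴴ)).re ≤ 2 := by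
    intro Y hY
    have := bw_main hn X Y hX
    rw [hY] at this
    linarith
  refine ⟨main, ?_⟩
  set k : Fin (n * n) := ⟨0, Nat.mul_pos hn hn⟩
  have h1 : trace (V k * (V k)ᴴ) = 1 := by rw [horth]; simp
  have h2 := main (V k) (by rw [h1]; simp)
  have h3 : trace (TX X (V k) * (V k)ᴴ) = (μ k : ℂ) := by
    rw [heig, Matrix.smul_mul, trace_smul, h1]; simp
  have h4 : trace (TX X (V k) * (V k)ᴴ)
      = trace ((X * V k - V k * X) * (X * V k - V k * X)ᴴ) := by
    unfold TX
    obtain ⟨Z, hZ⟩ : ∃ Z, X * V k - V k * X = Z := ⟨_, rfl⟩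
    have hZ' : Zᴴ = (X * V k - V k * X)ᴴ := by rw [hZ]
    rw [hZ, hZ', conjTranspose_sub, conjTranspose_mul, conjTranspose_mul, Matrix.sub_mul, Matrix.mul_sub,
      trace_sub, trace_sub, Matrix.mul_assoc Xᴴ, trace_mul_comm Xᴴ, Matrix.mul_assoc,
      Matrix.mul_assoc]
  rw [← h4, h3, Complex.ofReal_re] at h2
  exact h2
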